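/- Let n ≥ 1 and β > n. There is a constant C(n,β) such that for all positive reals a_1 ≥ a_2 ≥ ... ≥ a_{n+1} with a_i/a_{i+1} ≥ √2 for each i, the integral S(β; a_1,...,a_{n+1}) = ∫_{[0,π/2]^n} sin^{n−1}θ_1 ⋯ sin θ_{n−1} / (a_1 cos θ_1 + ⋯ + a_{n+1} sin θ_1 ⋯ sin θ_n)^β dθ_1⋯dθ_n satisfies S ≤ C(n,β)·a_1^{−1} a_2^{−1} ⋯ a_n^{−1} a_{n+1}^{−β+n}. -/

import Mathlib

open Real MeasureTheory Set

/-- `S β a` is the spherical-coordinates expression for the integral over the first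
octant of `S^n` of the `β`-th power of the radial function of the rhombus with
vertices `±(1/aᵢ)eᵢ`:
`S(β; a₁,…,a_{n+1}) = ∫_{[0,π/2]^n} sin^{n−1}θ₁ ⋯ sin θ_{n−1}
  / (a₁ cos θ₁ + a₂ sin θ₁ cos θ₂ + ⋯ + a_{n+1} sin θ₁ ⋯ sin θ_n)^β dθ₁⋯dθ_n`. -/
noncomputable def S (n : ℕ) (β : ℝ) (a : Fin (n+1) → ℝ) : ℝ :=
  ∫ θ in Set.univ.pi (fun _ : Fin n => Set.Icc 0 (π/2)),
    (∏ j : Fin n, Real.sin (θ j) ^ (n - 1 - (j : ℕ))) /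
      (∑ i : Fin (n+1),
        a i * (∏ j : Fin n, if (j : ℕ) < (i : ℕ) then Real.sin (θ j) else 1) *
          (if h : (i : ℕ) < n then Real.cos (θ ⟨i, h⟩) else 1)) ^ β

/-- The gauge of the rhombus with vertices `±(1/aᵢ)eᵢ` at the point of the unit sphere with
spherical coordinates `θ`. -/
noncomputable def rhombusGauge (n : ℕ) (a : Fin (n + 1) → ℝ) (θ : Fin n → ℝ) : ℝ :=
  ∑ i : Fin (n+1),
    a i * (∏ j : Fin n, if (j : ℕ) < (i : ℕ) then Real.sin (θ j) else 1) *
      (if h : (i : ℕ) < n then Real.cos (θ ⟨i, h⟩) else 1)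

/-- The density of the spherical measure in spherical coordinates. -/
noncomputable def sphericalDensity (n : ℕ) (θ : Fin n → ℝ) : ℝ :=
  ∏ j : Fin n, Real.sin (θ j) ^ (n - 1 - (j : ℕ))

lemma rhombusGauge_cons (n : ℕ) (a : Fin (n + 2) → ℝ) (x : ℝ) (θ : Fin n → ℝ) :
    rhombusGauge (n + 1) a (Fin.cons x θ) =
      a 0 * Real.cos x + Real.sin x * rhombusGauge n (Fin.tail a) θ := by
  unfold rhombusGauge
  rw [Fin.sum_univ_succ, Finset.mul_sum]
  congr 1
  · simp
  · refine Finset.sum_congr rfl fun i _ => ?_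
    rw [Fin.prod_univ_succ]
    have hcos : (if h : (i.succ : ℕ) < n + 1
          then Real.cos ((Fin.cons x θ : Fin (n + 1) → ℝ) ⟨i.succ, h⟩) else 1) =
        if h : (i : ℕ) < n then Real.cos (θ ⟨i, h⟩) else 1 := by
      by_cases h : (i : ℕ) < n
      · have h' : (i.succ : ℕ) < n + 1 := by simpa using h
        have hi : (⟨(i.succ : ℕ), h'⟩ : Fin (n + 1)) = Fin.succ ⟨i, h⟩ := by
          ext; simp
        rw [dif_pos h, dif_pos h', hi, Fin.cons_succ]
      · have h' : ¬ (i.succ : ℕ) < n + 1 := by simpa using h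
        rw [dif_neg h, dif_neg h']
    rw [hcos]
    simp only [Fin.val_zero, Fin.val_succ, Fin.cons_zero, Fin.cons_succ, Nat.zero_lt_succ,
      if_true, Nat.add_lt_add_iff_right, Fin.tail]
    ring

lemma sphericalDensity_cons (n : ℕ) (x : ℝ) (θ : Fin n → ℝ) :
    sphericalDensity (n + 1) (Fin.cons x θ) = Real.sin x ^ n * sphericalDensity n θ := by
  unfold sphericalDensity
  rw [Fin.prod_univ_succ]
  congr 1
  refine Finset.prod_congr rfl fun i _ => ?_
  rw [Fin.cons_succ, Fin.val_succ]
  congr 1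
  omega

lemma measurable_rhombusGauge (n : ℕ) (a : Fin (n + 1) → ℝ) :
    Measurable (rhombusGauge n a) := by
  unfold rhombusGauge
  refine Finset.measurable_fun_sum _ fun i _ => ?_
  refine (measurable_const.mul (Finset.measurable_fun_prod _ fun j _ => ?_)).mul ?_
  · split_ifs <;> fun_prop
  · split_ifs <;> fun_prop

lemma measurable_sphericalDensity (n : ℕ) : Measurable (sphericalDensity n) := by
  unfold sphericalDensity
  fun_prop

lemma measurable_sphericalDensity_div_rhombusGauge_rpow (n : ℕ) (a : Fin (n + 1) → ℝ) (β : ℝ) :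
    Measurable fun θ => sphericalDensity n θ / rhombusGauge n a θ ^ β :=
  (measurable_sphericalDensity n).div ((measurable_rhombusGauge n a).pow_const β)

lemma sin_nonneg_of_mem_quadrant {x : ℝ} (hx : x ∈ Icc 0 (π / 2)) : 0 ≤ Real.sin x :=
  Real.sin_nonneg_of_nonneg_of_le_pi hx.1 (by linarith [hx.2, Real.pi_pos])

lemma cos_nonneg_of_mem_quadrant {x : ℝ} (hx : x ∈ Icc 0 (π / 2)) : 0 ≤ Real.cos x :=
  Real.cos_nonneg_of_mem_Icc ⟨by linarith [hx.1, Real.pi_pos], hx.2⟩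

lemma sphericalDensity_nonneg {n : ℕ} {θ : Fin n → ℝ} (hθ : ∀ j, θ j ∈ Icc 0 (π / 2)) :
    0 ≤ sphericalDensity n θ :=
  Finset.prod_nonneg fun j _ => pow_nonneg (sin_nonneg_of_mem_quadrant (hθ j)) _

lemma rhombusGauge_pos {n : ℕ} {a : Fin (n + 1) → ℝ} (ha : ∀ i, 0 < a i) {θ : Fin n → ℝ}
    (hθ : ∀ j, θ j ∈ Icc 0 (π / 2)) : 0 < rhombusGauge n a θ := by
  induction n with
  | zero => simpa [rhombusGauge] using ha 0
  | succ n ih =>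
    rw [← Fin.cons_self_tail θ, rhombusGauge_cons]
    have hR := ih (a := Fin.tail a) (fun i => ha i.succ) (θ := Fin.tail θ) fun j => hθ j.succ
    have hs := sin_nonneg_of_mem_quadrant (hθ 0)
    have hc := cos_nonneg_of_mem_quadrant (hθ 0)
    rcases hs.eq_or_lt with h | h
    · have hc' : 0 < Real.cos (θ 0) := by
        refine hc.lt_of_ne fun h' => ?_
        have := Real.sin_sq_add_cos_sq (θ 0)
        rw [← h, ← h'] at this
        norm_num at this
      have := mul_pos (ha 0) hc'
      have := mul_nonneg hs hR.le
      linarith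
    · have := mul_pos h hR
      have := mul_nonneg (ha 0).le hc
      linarith

lemma rhombusGauge_le {n : ℕ} {a : Fin (n + 1) → ℝ} (ha : ∀ i, 0 < a i) {M : ℝ}
    (haM : ∀ i, a i ≤ M) {θ : Fin n → ℝ} (hθ : ∀ j, θ j ∈ Icc 0 (π / 2)) :
    rhombusGauge n a θ ≤ (n + 1) * M := by
  have hterm : ∀ i : Fin (n + 1),
      a i * (∏ j : Fin n, if (j : ℕ) < (i : ℕ) then Real.sin (θ j) else 1) *
        (if h : (i : ℕ) < n then Real.cos (θ ⟨i, h⟩) else 1) ≤ M := by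
    intro i
    have hP0 : 0 ≤ ∏ j : Fin n, if (j : ℕ) < (i : ℕ) then Real.sin (θ j) else 1 :=
      Finset.prod_nonneg fun j _ => by
        split_ifs
        · exact sin_nonneg_of_mem_quadrant (hθ j)
        · exact zero_le_one
    have hP1 : (∏ j : Fin n, if (j : ℕ) < (i : ℕ) then Real.sin (θ j) else 1) ≤ 1 :=
      Finset.prod_le_one (fun j _ => by
        split_ifs
        · exact sin_nonneg_of_mem_quadrant (hθ j)
        · exact zero_le_one) fun j _ => by
        split_ifs
        · exact Real.sin_le_one _
        · exact le_rfl
    have hc : (if h : (i : ℕ) < n then Real.cos (θ ⟨i, h⟩) else 1) ≤ 1 := by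
      split_ifs
      · exact Real.cos_le_one _
      · exact le_rfl
    calc _ ≤ a i * (∏ j : Fin n, if (j : ℕ) < (i : ℕ) then Real.sin (θ j) else 1) :=
          mul_le_of_le_one_right (mul_nonneg (ha i).le hP0) hc
      _ ≤ a i := mul_le_of_le_one_right (ha i).le hP1
      _ ≤ M := haM i
  calc rhombusGauge n a θ ≤ ∑ _i : Fin (n + 1), M := Finset.sum_le_sum fun i _ => hterm i
    _ = (n + 1) * M := by simp

lemma integral_affine_rpow_le {a R β : ℝ} (ha : 0 < a) (hR : 0 < R) (hβ : 1 < β) :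
    ∫ x in (0)..(π / 2), (a * (1 - 2 / π * x) + R) ^ (-β) ≤
      π / (2 * (β - 1)) * a⁻¹ * R ^ (1 - β) := by
  have hπ := Real.pi_pos
  have hβ' : β - 1 ≠ 0 := by linarith
  have hpos : ∀ x ∈ uIcc 0 (π / 2), 0 < a * (1 - 2 / π * x) + R := by
    intro x hx
    rw [uIcc_of_le (by positivity)] at hx
    have : 2 / π * x ≤ 1 := by
      calc 2 / π * x ≤ 2 / π * (π / 2) := by gcongr; exact hx.2
        _ = 1 := by field_simp
    have : 0 ≤ a * (1 - 2 / π * x) := mul_nonneg ha.le (by linarith)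
    linarith
  have hderiv : ∀ x ∈ uIcc 0 (π / 2),
      HasDerivAt (fun x => π / (2 * (β - 1)) * a⁻¹ * (a * (1 - 2 / π * x) + R) ^ (1 - β))
        ((a * (1 - 2 / π * x) + R) ^ (-β)) x := by
    intro x hx
    have h1 : HasDerivAt (fun x : ℝ => a * (1 - 2 / π * x) + R) (a * (-(2 / π * 1))) x :=
      ((((hasDerivAt_id x).const_mul (2 / π)).const_sub 1).const_mul a).add_const R
    have h2 := (h1.rpow_const (p := 1 - β) (Or.inl (hpos x hx).ne')).const_mul
      (π / (2 * (β - 1)) * a⁻¹)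
    rw [show 1 - β - 1 = -β by ring] at h2
    refine h2.congr_deriv ?_
    field_simp
    ring
  have hcont : ContinuousOn (fun x => (a * (1 - 2 / π * x) + R) ^ (-β)) (uIcc 0 (π / 2)) :=
    ContinuousOn.rpow_const (by fun_prop) fun x hx => Or.inl (hpos x hx).ne'
  rw [intervalIntegral.integral_eq_sub_of_hasDerivAt hderiv hcont.intervalIntegrable]
  have hend : a * (1 - 2 / π * (π / 2)) + R = R := by field_simp; ring
  simp only [hend]
  have hb : 0 < β - 1 := by linarith
  refine sub_le_self _ (mul_nonneg (by positivity) (Real.rpow_nonneg ?_ _))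
  exact (hpos 0 left_mem_uIcc).le

lemma lintegral_quadrant_le {a R β c P : ℝ} (m : ℕ) (ha : 0 < a) (hR : 0 < R) (hβ : 1 < β)
    (hc : 0 ≤ c) (hRa : R ≤ c * a) (hP : 0 ≤ P) :
    ∫⁻ x in Icc 0 (π / 2),
        ENNReal.ofReal (Real.sin x ^ m * P / (a * Real.cos x + Real.sin x * R) ^ β) ≤
      ENNReal.ofReal
        ((1 + c) ^ β * (π / (2 * (β - 1))) * a⁻¹ * (P / R ^ (β - 1))) := by
  have hπ := Real.pi_pos
  set g : ℝ → ℝ := fun x => (1 + c) ^ β * P * (a * (1 - 2 / π * x) + R) ^ (-β) with hg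
  have hu : ∀ x ∈ Icc 0 (π / 2), 0 ≤ 1 - 2 / π * x := by
    intro x hx
    have : 2 / π * x ≤ 1 := by
      calc 2 / π * x ≤ 2 / π * (π / 2) := by gcongr; exact hx.2
        _ = 1 := by field_simp
    linarith
  have hpos : ∀ x ∈ Icc 0 (π / 2), 0 < a * (1 - 2 / π * x) + R := fun x hx => by
    have := mul_nonneg ha.le (hu x hx)
    linarith
  have hg0 : ∀ x ∈ Icc 0 (π / 2), 0 ≤ g x := fun x hx =>
    mul_nonneg (mul_nonneg (by positivity) hP) (Real.rpow_nonneg (hpos x hx).le _)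
  have hbound : ∀ x ∈ Icc 0 (π / 2),
      Real.sin x ^ m * P / (a * Real.cos x + Real.sin x * R) ^ β ≤ g x := by
    intro x hx
    have hs := sin_nonneg_of_mem_quadrant hx
    have hsin : 2 / π * x ≤ Real.sin x := Real.mul_le_sin hx.1 hx.2
    have hcos : 1 - 2 / π * x ≤ Real.cos x := by
      have := Real.mul_le_sin (x := π / 2 - x) (by linarith [hx.2]) (by linarith [hx.1])
      rw [Real.sin_pi_div_two_sub] at this
      calc 1 - 2 / π * x = 2 / π * (π / 2 - x) := by field_simp
        _ ≤ _ := this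
    have hden : (a * (1 - 2 / π * x) + R) / (1 + c) ≤ a * Real.cos x + Real.sin x * R := by
      rw [div_le_iff₀ (by linarith)]
      have h1 := mul_le_mul_of_nonneg_left hcos ha.le
      have h2 := mul_le_mul_of_nonneg_right hsin hR.le
      have h3 := mul_le_mul_of_nonneg_left hRa (hu x hx)
      have h4 : 0 ≤ c * (2 / π * x * R) := by
        have := hx.1
        positivity
      nlinarith [mul_le_mul_of_nonneg_right (add_le_add h1 h2) (by linarith : 0 ≤ 1 + c)]
    have hq : 0 < (a * (1 - 2 / π * x) + R) / (1 + c) := div_pos (hpos x hx) (by linarith)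
    calc Real.sin x ^ m * P / (a * Real.cos x + Real.sin x * R) ^ β
        ≤ P / ((a * (1 - 2 / π * x) + R) / (1 + c)) ^ β := by
          refine div_le_div₀ hP ?_ (Real.rpow_pos_of_pos hq _)
            (Real.rpow_le_rpow hq.le hden (by linarith))
          exact mul_le_of_le_one_left hP (pow_le_one₀ hs (Real.sin_le_one x))
      _ = g x := by
          simp only [hg]
          rw [Real.div_rpow (hpos x hx).le (by linarith), Real.rpow_neg (hpos x hx).le]
          have := Real.rpow_pos_of_pos (hpos x hx) β
          have : 0 < (1 + c) ^ β := Real.rpow_pos_of_pos (by linarith) β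
          field_simp
  have hint : IntegrableOn g (Icc 0 (π / 2)) := by
    refine ContinuousOn.integrableOn_Icc (continuousOn_const.mul ?_)
    exact ContinuousOn.rpow_const (by fun_prop) fun x hx => Or.inl (hpos x hx).ne'
  calc _ ≤ ∫⁻ x in Icc 0 (π / 2), ENNReal.ofReal (g x) :=
        setLIntegral_mono' measurableSet_Icc fun x hx => ENNReal.ofReal_le_ofReal (hbound x hx)
    _ = ENNReal.ofReal (∫ x in Icc 0 (π / 2), g x) :=
        (ofReal_integral_eq_lintegral_ofReal hint
          ((ae_restrict_iff' measurableSet_Icc).2 (ae_of_all _ hg0))).symm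
    _ ≤ _ := by
        refine ENNReal.ofReal_le_ofReal ?_
        rw [integral_Icc_eq_integral_Ioc, ← intervalIntegral.integral_of_le (by positivity), hg,
          intervalIntegral.integral_const_mul]
        calc _ ≤ (1 + c) ^ β * P * (π / (2 * (β - 1)) * a⁻¹ * R ^ (1 - β)) :=
              mul_le_mul_of_nonneg_left (integral_affine_rpow_le ha hR hβ) (by positivity)
          _ = _ := by
              rw [show 1 - β = -(β - 1) by ring, Real.rpow_neg hR.le]
              ring

lemma lintegral_pi_restrict_succ (n : ℕ) (s : Set ℝ) {f : (Fin (n + 1) → ℝ) → ENNReal}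
    (hf : Measurable f) :
    ∫⁻ θ in univ.pi (fun _ => s), f θ =
      ∫⁻ θ in univ.pi (fun _ : Fin n => s), ∫⁻ x in s, f (Fin.cons x θ) := by
  have hmp := (measurePreserving_piFinSuccAbove
    (fun _ : Fin (n + 1) => (volume : Measure ℝ).restrict s) 0).symm
  simp only [volume_pi, Measure.restrict_pi_pi]
  rw [← hmp.lintegral_comp hf, lintegral_prod_symm' (fun z => f _) (hf.comp (MeasurableEquiv.measurable _))]
  simp [MeasurableEquiv.piFinSuccAbove, Fin.insertNthEquiv, Fin.insertNth_zero']

lemma exists_lintegral_rhombusGauge_le (n : ℕ) (β : ℝ) (hβ : (n : ℝ) < β) :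
    ∃ C : ℝ, 0 ≤ C ∧ ∀ a : Fin (n + 1) → ℝ, (∀ i, 0 < a i) → Antitone a →
      ∫⁻ θ in univ.pi (fun _ : Fin n => Icc 0 (π / 2)),
          ENNReal.ofReal (sphericalDensity n θ / rhombusGauge n a θ ^ β) ≤
        ENNReal.ofReal
          (C * (∏ i : Fin n, (a i.castSucc)⁻¹) * a (Fin.last n) ^ ((n : ℝ) - β)) := by
  induction n generalizing β with
  | zero =>
    refine ⟨1, zero_le_one, fun a ha _ => ?_⟩
    rw [volume_pi, Measure.restrict_pi_pi, Measure.pi_of_empty, lintegral_dirac]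
    simp [sphericalDensity, rhombusGauge, Real.rpow_neg (ha 0).le]
  | succ n ih =>
    push_cast at hβ
    have hn : (0 : ℝ) ≤ n := n.cast_nonneg
    obtain ⟨C, hC, h⟩ := ih (β - 1) (by linarith)
    have hβ1 : 0 < β - 1 := by linarith
    set K : ℝ := (1 + (n + 1)) ^ β * (π / (2 * (β - 1))) with hK
    have hK0 : 0 ≤ K := by have := Real.pi_pos; positivity
    refine ⟨K * C, mul_nonneg hK0 hC, fun a ha hanti => ?_⟩
    have hKa : 0 ≤ K * (a 0)⁻¹ := mul_nonneg hK0 (inv_nonneg.2 (ha 0).le)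
    have hbox : MeasurableSet (univ.pi fun _ : Fin n => Icc (0 : ℝ) (π / 2)) :=
      MeasurableSet.univ_pi fun _ => measurableSet_Icc
    rw [lintegral_pi_restrict_succ _ _
      (measurable_sphericalDensity_div_rhombusGauge_rpow (n + 1) a β).ennreal_ofReal]
    calc _ ≤ ∫⁻ θ in univ.pi (fun _ : Fin n => Icc 0 (π / 2)),
            ENNReal.ofReal (K * (a 0)⁻¹) * ENNReal.ofReal
              (sphericalDensity n θ / rhombusGauge n (Fin.tail a) θ ^ (β - 1)) := by
          refine setLIntegral_mono' hbox fun θ hθ => ?_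
          have hθ' : ∀ j, θ j ∈ Icc 0 (π / 2) := fun j => hθ j trivial
          rw [← ENNReal.ofReal_mul hKa]
          simp only [rhombusGauge_cons, sphericalDensity_cons]
          exact lintegral_quadrant_le n (ha 0) (rhombusGauge_pos (fun i => ha i.succ) hθ')
            (by linarith) (by positivity)
            (rhombusGauge_le (fun i => ha i.succ) (fun i => hanti (Fin.zero_le i.succ)) hθ')
            (sphericalDensity_nonneg hθ')
      _ = ENNReal.ofReal (K * (a 0)⁻¹) *
            ∫⁻ θ in univ.pi (fun _ : Fin n => Icc 0 (π / 2)), ENNReal.ofReal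
              (sphericalDensity n θ / rhombusGauge n (Fin.tail a) θ ^ (β - 1)) :=
          lintegral_const_mul' _ _ ENNReal.ofReal_ne_top
      _ ≤ ENNReal.ofReal (K * (a 0)⁻¹) * ENNReal.ofReal
            (C * (∏ i : Fin n, (Fin.tail a i.castSucc)⁻¹) *
              Fin.tail a (Fin.last n) ^ ((n : ℝ) - (β - 1))) := by
          gcongr
          exact h (Fin.tail a) (fun i => ha i.succ)
            fun i j hij => hanti (Fin.succ_le_succ_iff.2 hij)
      _ = _ := by
          rw [← ENNReal.ofReal_mul hKa, Fin.prod_univ_succ]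
          congr 1
          simp only [Fin.tail, Fin.castSucc_zero, Fin.succ_last, Fin.succ_castSucc]
          rw [show ((n : ℝ) - (β - 1)) = ((n + 1 : ℕ) : ℝ) - β by push_cast; ring]
          ring

theorem S_bound_beta_gt_n (n : ℕ) (hn : 1 ≤ n) (β : ℝ) (hβ : (n : ℝ) < β) :
    ∃ C : ℝ, ∀ a : Fin (n+1) → ℝ, (∀ i, 0 < a i) → Antitone a →
      (∀ i : Fin n, Real.sqrt 2 * a i.succ ≤ a i.castSucc) →
      S n β a ≤ C * (∏ i : Fin n, (a i.castSucc)⁻¹) * a (Fin.last n) ^ ((n : ℝ) - β) := by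
  obtain ⟨C, hC, h⟩ := exists_lintegral_rhombusGauge_le n β hβ
  refine ⟨C, fun a ha hanti _ => ?_⟩
  have hbox : MeasurableSet (univ.pi fun _ : Fin n => Icc (0 : ℝ) (π / 2)) :=
    MeasurableSet.univ_pi fun _ => measurableSet_Icc
  have hS : S n β a = ∫ θ in univ.pi (fun _ : Fin n => Icc 0 (π / 2)),
      sphericalDensity n θ / rhombusGauge n a θ ^ β := rfl
  rw [hS, integral_eq_lintegral_of_nonneg_ae _
    (measurable_sphericalDensity_div_rhombusGauge_rpow n a β).aestronglyMeasurable]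
  · refine ENNReal.toReal_le_of_le_ofReal ?_ (h a ha hanti)
    exact mul_nonneg (mul_nonneg hC (Finset.prod_nonneg fun i _ => inv_nonneg.2 (ha _).le))
      (Real.rpow_nonneg (ha _).le _)
  · refine (ae_restrict_iff' hbox).2 (ae_of_all _ fun θ hθ => ?_)
    have hθ' : ∀ j, θ j ∈ Icc 0 (π / 2) := fun j => hθ j trivial
    exact div_nonneg (sphericalDensity_nonneg hθ')
      (Real.rpow_nonneg (rhombusGauge_pos ha hθ').le _)
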